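/- Let H be a separable real Hilbert space and let (S_t)_{t≥0} be a C₀-semigroup on H which is pseudo-contractive, i.e., there exists ω ∈ ℝ such that ‖S_t‖ ≤ e^{ωt} for all t ≥ 0. Then there exist a separable real Hilbert space ℋ, a C₀-group (U_t)_{t∈ℝ} on ℋ, and an isometric bounded linear embedding ℓ : H → ℋ such that, with π := ℓ* denoting the adjoint of ℓ, one has π U_t ℓ = S_t for all t ≥ 0. -/

import Mathlib

open scoped InnerProductSpace

section SmallModel

/-- An orthonormal family in a separable space is countable. -/
theorem Orthonormal.countable_of_secondCountable {E ι : Type*} [NormedAddCommGroup E]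
    [InnerProductSpace ℝ E] [SecondCountableTopology E] {v : ι → E} (hv : Orthonormal ℝ v) :
    Countable ι := by
  have hdist : ∀ i j, i ≠ j → 1 < dist (v i) (v j) := by
    intro i j hij
    have h := norm_sub_sq_real (v i) (v j)
    rw [hv.1 i, hv.1 j, hv.2 hij] at h
    rw [dist_eq_norm]
    nlinarith [norm_nonneg (v i - v j)]
  have hdisj : (Set.univ : Set ι).PairwiseDisjoint fun i => Metric.ball (v i) (1 / 2) := by
    intro i _ j _ hij
    exact Metric.ball_disjoint_ball (by linarith [hdist i j hij])
  exact Set.countable_univ_iff.1 <| hdisj.countable_of_isOpen (fun _ _ => Metric.isOpen_ball)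
    fun i _ => Metric.nonempty_ball.2 (by norm_num)

/-- A separable real Hilbert space in any universe is isometric to some `ℓ²(I)` with `I ⊆ ℕ`. -/
theorem exists_linearIsometryEquiv_lp_nat (E : Type*) [NormedAddCommGroup E]
    [InnerProductSpace ℝ E] [SecondCountableTopology E] [CompleteSpace E] :
    ∃ I : Set ℕ, Nonempty (E ≃ₗᵢ[ℝ] lp (fun _ : I => ℝ) 2) := by
  obtain ⟨w, b, -⟩ := exists_hilbertBasis ℝ E
  have := b.orthonormal.countable_of_secondCountable
  obtain ⟨j, hj⟩ := exists_injective_nat w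
  let e := Equiv.ofInjective j hj
  have hsp : ⊤ ≤ (Submodule.span ℝ (Set.range (b ∘ e.symm))).topologicalClosure := by
    rw [e.symm.surjective.range_comp, b.dense_span]
  exact ⟨Set.range j,
    ⟨(HilbertBasis.mk (b.orthonormal.comp e.symm e.symm.injective) hsp).repr⟩⟩

end SmallModel

section GramExtension

variable {ι E F : Type*} [NormedAddCommGroup E] [InnerProductSpace ℝ E]
  [NormedAddCommGroup F] [InnerProductSpace ℝ F]

theorem norm_linearCombination_eq_of_inner_eq {φ : ι → E} {ψ : ι → F}
    (h : ∀ i j, ⟪φ i, φ j⟫_ℝ = ⟪ψ i, ψ j⟫_ℝ) (x : ι →₀ ℝ) :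
    ‖Finsupp.linearCombination ℝ φ x‖ = ‖Finsupp.linearCombination ℝ ψ x‖ := by
  rw [← sq_eq_sq₀ (norm_nonneg _) (norm_nonneg _), ← real_inner_self_eq_norm_sq,
    ← real_inner_self_eq_norm_sq]
  simp only [Finsupp.linearCombination_apply, Finsupp.sum_inner, Finsupp.inner_sum,
    inner_smul_left, inner_smul_right, h]

/-- Families with equal Gram matrices are related by a contraction, if the first is total. -/
theorem exists_continuousLinearMap_of_inner_eq [CompleteSpace F] {φ : ι → E} {ψ : ι → F}
    (hφ : Dense (Submodule.span ℝ (Set.range φ) : Set E))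
    (h : ∀ i j, ⟪φ i, φ j⟫_ℝ = ⟪ψ i, ψ j⟫_ℝ) :
    ∃ U : E →L[ℝ] F, (∀ i, U (φ i) = ψ i) ∧ ∀ x, ‖U x‖ ≤ ‖x‖ := by
  have hd : DenseRange (Finsupp.linearCombination ℝ φ) := by
    rw [DenseRange, ← LinearMap.coe_range, Finsupp.range_linearCombination]
    exact hφ
  have hn : ∀ x, ‖Finsupp.linearCombination ℝ ψ x‖ ≤ 1 * ‖Finsupp.linearCombination ℝ φ x‖ :=
    fun x => by rw [one_mul, norm_linearCombination_eq_of_inner_eq h]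
  refine ⟨(Finsupp.linearCombination ℝ ψ).extendOfNorm (Finsupp.linearCombination ℝ φ),
    fun i => ?_, fun x => ?_⟩
  · simpa using LinearMap.extendOfNorm_eq hd ⟨1, hn⟩ (Finsupp.single i (1 : ℝ))
  · simpa using LinearMap.norm_extendOfNorm_apply_le hd 1 hn x

end GramExtension

section StrongContinuity

/-- Strong continuity of a family of contractions only needs to be checked on a total set. -/
theorem continuous_apply_of_dense_span {X E F : Type*} [TopologicalSpace X]
    [NormedAddCommGroup E] [NormedSpace ℝ E] [NormedAddCommGroup F] [NormedSpace ℝ F]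
    {U : X → E →L[ℝ] F} (hU : ∀ t x, ‖U t x‖ ≤ ‖x‖) {s : Set E}
    (hs : Dense (Submodule.span ℝ s : Set E)) (hc : ∀ x ∈ s, Continuous fun t => U t x) (x : E) :
    Continuous fun t => U t x := by
  have hspan : ∀ y ∈ Submodule.span ℝ s, Continuous fun t => U t y := by
    intro y hy
    induction hy using Submodule.span_induction with
    | mem y hy => exact hc y hy
    | zero => simpa using continuous_const
    | add y z _ _ hy hz => simpa only [map_add] using Continuous.fun_add hy hz
    | smul a y _ hy => simpa only [map_smul] using Continuous.fun_const_smul hy a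
  refine continuous_of_uniform_approx_of_continuous fun u hu => ?_
  obtain ⟨ε, hε, hεu⟩ := Metric.mem_uniformity_dist.1 hu
  obtain ⟨y, hy, hxy⟩ := hs.exists_dist_lt x hε
  refine ⟨fun t => U t y, hspan y hy, fun t => hεu ?_⟩
  rw [dist_eq_norm, ← map_sub]
  exact (hU t _).trans_lt (by rwa [← dist_eq_norm])

end StrongContinuity

section Dilation

universe u

variable {H : Type u} [NormedAddCommGroup H] [InnerProductSpace ℝ H] [CompleteSpace H]

/-- The extension of a one-sided operator family to `ℝ` with `T (-t) = (T t)†`. -/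
noncomputable def adjointExtension (T : ℝ → H →L[ℝ] H) (t : ℝ) : H →L[ℝ] H :=
  if 0 ≤ t then T t else ContinuousLinearMap.adjoint (T (-t))

theorem adjointExtension_of_nonneg (T : ℝ → H →L[ℝ] H) {t : ℝ} (ht : 0 ≤ t) :
    adjointExtension T t = T t := if_pos ht

theorem adjoint_adjointExtension {T : ℝ → H →L[ℝ] H} (hT0 : T 0 = .id ℝ H) (t : ℝ) :
    ContinuousLinearMap.adjoint (adjointExtension T t) = adjointExtension T (-t) := by
  rcases lt_trichotomy t 0 with h | rfl | h
  · simp [adjointExtension, h.not_ge, h.le]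
  · simp [adjointExtension, hT0, ← ContinuousLinearMap.one_def,
      ← ContinuousLinearMap.star_eq_adjoint]
  · simp [adjointExtension, h.not_ge, h.le]

theorem inner_adjointExtension_self (T : ℝ → H →L[ℝ] H) (t : ℝ) (v : H) :
    ⟪adjointExtension T t v, v⟫_ℝ = ⟪T |t| v, v⟫_ℝ := by
  rcases le_or_gt 0 t with h | h
  · rw [adjointExtension_of_nonneg T h, abs_of_nonneg h]
  · rw [adjointExtension, if_neg h.not_ge, abs_of_neg h, ContinuousLinearMap.adjoint_inner_left,
      real_inner_comm]

/-- For a contraction semigroup, the quadratic form of its Toeplitz kernel dominates the squared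
norm of the state reached at any later time. -/
theorem norm_sq_sum_le_sum_adjointExtension {T : ℝ → H →L[ℝ] H} (hT0 : T 0 = .id ℝ H)
    (hTadd : ∀ s t, 0 ≤ s → 0 ≤ t → T (s + t) = (T s).comp (T t))
    (hT : ∀ t, 0 ≤ t → ∀ x, ‖T t x‖ ≤ ‖x‖) (h : ℝ → H) (s : Finset ℝ) :
    ∀ a, (∀ t ∈ s, t ≤ a) → ‖∑ t ∈ s, T (a - t) (h t)‖ ^ 2 ≤
      ∑ t ∈ s, ∑ r ∈ s, ⟪adjointExtension T (r - t) (h t), h r⟫_ℝ := by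
  induction s using Finset.induction_on_max with
  | empty => simp
  | insert b s hb ih =>
    intro a ha
    have hbs : b ∉ s := fun hmem => lt_irrefl _ (hb b hmem)
    have hba : b ≤ a := ha b (Finset.mem_insert_self _ _)
    set y : H := ∑ t ∈ s, T (b - t) (h t) with hy
    have hstate : ∑ t ∈ insert b s, T (a - t) (h t) = T (a - b) (h b + y) := by
      rw [Finset.sum_insert hbs, map_add, hy, map_sum]
      congr 1
      refine Finset.sum_congr rfl fun t ht => ?_
      rw [show a - t = (a - b) + (b - t) by ring,
        hTadd _ _ (sub_nonneg.2 hba) (sub_nonneg.2 (hb t ht).le)]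
      rfl
    have hcol : ∑ t ∈ s, ⟪adjointExtension T (b - t) (h t), h b⟫_ℝ = ⟪y, h b⟫_ℝ := by
      rw [hy, sum_inner]
      refine Finset.sum_congr rfl fun t ht => ?_
      rw [adjointExtension_of_nonneg T (sub_nonneg.2 (hb t ht).le)]
    have hrow : ∑ r ∈ s, ⟪adjointExtension T (r - b) (h b), h r⟫_ℝ = ⟪y, h b⟫_ℝ := by
      rw [← hcol]
      refine Finset.sum_congr rfl fun r _ => ?_
      rw [← neg_sub b r, ← adjoint_adjointExtension hT0, ContinuousLinearMap.adjoint_inner_left,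
        real_inner_comm]
    have hdiag : ⟪adjointExtension T (b - b) (h b), h b⟫_ℝ = ‖h b‖ ^ 2 := by
      simp [adjointExtension, hT0]
    rw [hstate]
    simp only [Finset.sum_insert hbs, Finset.sum_add_distrib, hcol, hrow, hdiag]
    have h1 := ih b fun t ht => (hb t ht).le
    have h2 := pow_le_pow_left₀ (norm_nonneg _) (hT (a - b) (sub_nonneg.2 hba) (h b + y)) 2
    have h3 := norm_add_sq_real (h b) y
    rw [real_inner_comm] at h3
    linarith

theorem posSemidef_adjointExtension {T : ℝ → H →L[ℝ] H} (hT0 : T 0 = .id ℝ H)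
    (hTadd : ∀ s t, 0 ≤ s → 0 ≤ t → T (s + t) = (T s).comp (T t))
    (hT : ∀ t, 0 ≤ t → ∀ x, ‖T t x‖ ≤ ‖x‖) :
    (Matrix.of fun s t : ℝ => adjointExtension T (s - t)).PosSemidef := by
  have h := (RKHS.posSemidef_tfae
    (K := Matrix.of fun s t : ℝ => adjointExtension T (s - t))).out 0 2
  refine h.2 ⟨?_, fun v => ?_⟩
  · ext1 s t
    simp [Matrix.conjTranspose_apply, ContinuousLinearMap.star_eq_adjoint,
      adjoint_adjointExtension hT0]
  · obtain ⟨a, ha⟩ := v.support.bddAbove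
    exact (sq_nonneg _).trans
      (norm_sq_sum_le_sum_adjointExtension hT0 hTadd hT v v.support a fun t ht => ha ht)

/-- The Toeplitz kernel of a contraction semigroup is the Gram kernel of a total family of
operators into some Hilbert space. -/
theorem exists_total_family_of_contraction_semigroup {T : ℝ → H →L[ℝ] H}
    (hT0 : T 0 = .id ℝ H) (hTadd : ∀ s t, 0 ≤ s → 0 ≤ t → T (s + t) = (T s).comp (T t))
    (hT : ∀ t, 0 ≤ t → ∀ x, ‖T t x‖ ≤ ‖x‖) :
    ∃ (E : Type u) (_ : NormedAddCommGroup E) (_ : InnerProductSpace ℝ E) (_ : CompleteSpace E)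
      (φ : ℝ → H →L[ℝ] E),
      Dense (Submodule.span ℝ (Set.range fun p : ℝ × H => φ p.1 p.2) : Set E) ∧
      ∀ s t v w, ⟪φ s v, φ t w⟫_ℝ = ⟪adjointExtension T (t - s) v, w⟫_ℝ := by
  have : Fact (Matrix.of fun s t : ℝ => adjointExtension T (s - t)).PosSemidef :=
    ⟨posSemidef_adjointExtension hT0 hTadd hT⟩
  refine ⟨RKHS.OfKernel (Matrix.of fun s t : ℝ => adjointExtension T (s - t)), inferInstance,
    inferInstance, inferInstance, fun t => RKHS.kerFun _ t, ?_, fun s t v w => ?_⟩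
  · have hset : (Set.range fun p : ℝ × H => RKHS.kerFun (RKHS.OfKernel
        (Matrix.of fun s t : ℝ => adjointExtension T (s - t))) p.1 p.2) =
        {RKHS.kerFun _ x v | (x) (v)} := by
      ext; simp
    rw [hset, Submodule.dense_iff_topologicalClosure_eq_top]
    exact RKHS.kerFun_dense _
  · rw [← RKHS.kernel_inner, RKHS.OfKernel.kernel_ofKernel]
    rfl

/-- **Sz.-Nagy dilation of contraction semigroups**, in the universe of `H`. -/
theorem exists_dilation_of_contraction_semigroup [SecondCountableTopology H]
    {T : ℝ → H →L[ℝ] H} (hT0 : T 0 = .id ℝ H)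
    (hTadd : ∀ s t, 0 ≤ s → 0 ≤ t → T (s + t) = (T s).comp (T t))
    (hTcont : ∀ x, ContinuousOn (fun t => T t x) (Set.Ici 0))
    (hT : ∀ t, 0 ≤ t → ∀ x, ‖T t x‖ ≤ ‖x‖) :
    ∃ (E : Type u) (_ : NormedAddCommGroup E) (_ : InnerProductSpace ℝ E)
      (_ : SecondCountableTopology E) (_ : CompleteSpace E)
      (U : ℝ → E →L[ℝ] E) (ℓ : H →L[ℝ] E),
      U 0 = .id ℝ E ∧ (∀ s t, U (s + t) = (U s).comp (U t)) ∧
      (∀ x, Continuous fun t => U t x) ∧ (∀ x, ‖ℓ x‖ = ‖x‖) ∧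
      ∀ t, 0 ≤ t → ∀ x y, ⟪U t (ℓ x), ℓ y⟫_ℝ = ⟪T t x, y⟫_ℝ := by
  obtain ⟨E, _, _, _, φ, hdense, hφ⟩ := exists_total_family_of_contraction_semigroup hT0 hTadd hT
  have hnorm : ∀ t v, ‖φ t v‖ = ‖v‖ := by
    intro t v
    rw [← sq_eq_sq₀ (norm_nonneg _) (norm_nonneg _), ← real_inner_self_eq_norm_sq, hφ]
    simp [adjointExtension, hT0]
  have hφcont : ∀ v, Continuous fun t => φ t v := by
    intro v
    have habs : Continuous fun r : ℝ => ⟪T |r| v, v⟫_ℝ :=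
      ((hTcont v).comp_continuous continuous_abs fun r => abs_nonneg r).inner continuous_const
    refine continuous_iff_continuousAt.2 fun s => ?_
    rw [ContinuousAt, tendsto_iff_norm_sub_tendsto_zero]
    have hsq : ∀ t, ‖φ t v - φ s v‖ = √(2 * (‖v‖ ^ 2 - ⟪T |s - t| v, v⟫_ℝ)) := by
      intro t
      rw [← Real.sqrt_sq (norm_nonneg (φ t v - φ s v)), norm_sub_sq_real, hnorm, hnorm, hφ,
        inner_adjointExtension_self]
      ring_nf
    simp only [hsq]
    have hc : Continuous fun t => √(2 * (‖v‖ ^ 2 - ⟪T |s - t| v, v⟫_ℝ)) :=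
      ((continuous_const.sub (habs.comp (continuous_const.sub continuous_id))).const_mul 2).sqrt
    simpa [hT0] using hc.tendsto s
  have hsep : SecondCountableTopology E := by
    have hjoint : Continuous fun p : ℝ × H => φ p.1 p.2 :=
      continuous_prod_of_continuous_lipschitzWith' _ 1
        (fun t => LipschitzWith.of_dist_le_mul fun v w => by
          simp [dist_eq_norm, ← map_sub, hnorm]) hφcont
    have h := ((TopologicalSpace.isSeparable_range hjoint).span (R := ℝ)).closure
    rw [hdense.closure_eq, TopologicalSpace.isSeparable_univ_iff] at h
    exact UniformSpace.secondCountable_of_separable E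
  have hU : ∀ a : ℝ, ∃ U : E →L[ℝ] E,
      (∀ p : ℝ × H, U (φ p.1 p.2) = φ (p.1 - a) p.2) ∧ ∀ x, ‖U x‖ ≤ ‖x‖ := fun a =>
    exists_continuousLinearMap_of_inner_eq hdense fun p q => by
      rw [hφ, hφ, sub_sub_sub_cancel_right]
  choose U hUφ hUle using hU
  have hext : ∀ {A B : E →L[ℝ] E}, (∀ t v, A (φ t v) = B (φ t v)) → A = B := fun hAB =>
    ContinuousLinearMap.ext_on hdense (by rintro _ ⟨p, rfl⟩; exact hAB _ _)
  have hUφ' : ∀ a t v, U a (φ t v) = φ (t - a) v := fun a t v => hUφ a (t, v)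
  refine ⟨E, _, _, hsep, ‹_›, U, φ 0, hext fun t v => ?_, fun s t => hext fun r v => ?_,
    continuous_apply_of_dense_span hUle hdense ?_, hnorm 0, fun t ht x y => ?_⟩
  · simp [hUφ']
  · simp [hUφ', sub_sub, add_comm]
  · rintro _ ⟨p, rfl⟩
    simp only [hUφ']
    exact (hφcont p.2).comp (continuous_const.sub continuous_id)
  · rw [hUφ', hφ, sub_sub_cancel, adjointExtension_of_nonneg T ht]

end Dilation

/-- **Sz.-Nagy dilation.** Let `H` be a separable real Hilbert space and
`(S_t)_{t ≥ 0}` a pseudo-contractive `C₀`-semigroup on `H` (`‖S_t‖ ≤ e^{ωt}`). Then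
there exist a separable real Hilbert space `ℋ`, a `C₀`-group `(U_t)_{t ∈ ℝ}` on `ℋ`,
and an isometric embedding `ℓ : H → ℋ` such that, with `π := ℓ*`,
`π U_t ℓ = S_t` for all `t ≥ 0`. -/
theorem szNagy_dilation
    (H : Type*) [NormedAddCommGroup H] [InnerProductSpace ℝ H]
    [SecondCountableTopology H] [CompleteSpace H]
    (S : ℝ → (H →L[ℝ] H))
    (hS0 : S 0 = ContinuousLinearMap.id ℝ H)
    (hSadd : ∀ s t : ℝ, 0 ≤ s → 0 ≤ t → S (s + t) = (S s).comp (S t))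
    (hScont : ∀ x : H, ContinuousOn (fun t : ℝ => S t x) (Set.Ici (0 : ℝ)))
    (ω : ℝ) (hω : ∀ t : ℝ, 0 ≤ t → ‖S t‖ ≤ Real.exp (ω * t)) :
    ∃ (𝓗 : Type) (_ : NormedAddCommGroup 𝓗) (_ : InnerProductSpace ℝ 𝓗)
      (_ : SecondCountableTopology 𝓗) (_ : CompleteSpace 𝓗)
      (U : ℝ → (𝓗 →L[ℝ] 𝓗)) (ℓ : H →L[ℝ] 𝓗),
      U 0 = ContinuousLinearMap.id ℝ 𝓗 ∧
      (∀ s t : ℝ, U (s + t) = (U s).comp (U t)) ∧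
      (∀ x : 𝓗, Continuous fun t : ℝ => U t x) ∧
      (∀ x : H, ‖ℓ x‖ = ‖x‖) ∧
      (∀ t : ℝ, 0 ≤ t →
        (ContinuousLinearMap.adjoint ℓ).comp ((U t).comp ℓ) = S t) := by
  let T : ℝ → H →L[ℝ] H := fun t => Real.exp (-(ω * t)) • S t
  have hT0 : T 0 = .id ℝ H := by simp [T, hS0]
  have hTadd : ∀ s t, 0 ≤ s → 0 ≤ t → T (s + t) = (T s).comp (T t) := by
    intro s t hs ht
    ext x
    simp only [T, hSadd s t hs ht, mul_add, neg_add, Real.exp_add]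
    simp [smul_smul, mul_comm]
  have hTcont : ∀ x, ContinuousOn (fun t => T t x) (Set.Ici 0) := fun x =>
    ContinuousOn.smul (f := fun t => Real.exp (-(ω * t))) (by fun_prop) (hScont x)
  have hT : ∀ t, 0 ≤ t → ∀ x, ‖T t x‖ ≤ ‖x‖ := by
    intro t ht x
    calc ‖T t x‖ = Real.exp (-(ω * t)) * ‖S t x‖ := by
          simp [T, norm_smul, abs_of_pos (Real.exp_pos _)]
      _ ≤ Real.exp (-(ω * t)) * (Real.exp (ω * t) * ‖x‖) := by
          gcongr
          exact (S t).le_of_opNorm_le (hω t ht) x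
      _ = ‖x‖ := by rw [← mul_assoc, ← Real.exp_add]; simp
  obtain ⟨E, _, _, _, _, U, ℓ, hU0, hUadd, hUcont, hℓ, hdil⟩ :=
    exists_dilation_of_contraction_semigroup hT0 hTadd hTcont hT
  obtain ⟨I, ⟨e⟩⟩ := exists_linearIsometryEquiv_lp_nat E
  let e' : E →L[ℝ] lp (fun _ : I => ℝ) 2 := e.toContinuousLinearEquiv
  let f' : lp (fun _ : I => ℝ) 2 →L[ℝ] E := e.symm.toContinuousLinearEquiv
  have hsc : SecondCountableTopology (lp (fun _ : I => ℝ) 2) :=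
    e.toHomeomorph.symm.isEmbedding.secondCountableTopology
  refine ⟨lp (fun _ : I => ℝ) 2, inferInstance, inferInstance, hsc, inferInstance,
    fun t => Real.exp (ω * t) • e'.comp ((U t).comp f'), e'.comp ℓ, ?_, fun s t => ?_,
    fun x => ?_, fun x => ?_, fun t ht => ?_⟩
  · ext1 x
    simp [hU0, e', f']
  · ext1 x
    simp only [hUadd, mul_add, Real.exp_add]
    simp [e', f', smul_smul, mul_comm]
  · exact Continuous.smul (f := fun t => Real.exp (ω * t)) (by fun_prop)
      (e'.continuous.comp (hUcont (f' x)))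
  · simp [e', hℓ]
  · ext1 x
    refine ext_inner_right ℝ fun y => ?_
    simp [ContinuousLinearMap.adjoint_inner_left, e', f', inner_smul_left, hdil t ht, T,
      ← mul_assoc, ← Real.exp_add]
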